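/- Let A be a normal Noetherian domain and M an ideal module (a nonzero finitely generated torsion-free A-module whose double dual M** is free). If M is embedded into a finite free A-module G of positive rank, then widetilde(R(M))^S is isomorphic to widetilde(R(M))^T, where S = Sym_A(M**) and T = Sym_A(G). In particular, up to isomorphism, the Ratliff–Rush closure does not depend on the choice of the embedding of M into a finite free module. -/

import Mathlib

set_option maxHeartbeats 1000000
set_option synthInstance.maxHeartbeats 400000

open MvPolynomial IsLocalRing

/-- The embedding of the free module `A^r` onto the degree-one part of the
polynomial ring `Sym_A(A^r) = A[t_1, ..., t_r]`, sending `f` to `∑ i, f i • X i`. -/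
noncomputable abbrev emb (A : Type) [CommRing A] (r : ℕ) :
    (Fin r → A) →ₗ[A] MvPolynomial (Fin r) A :=
  Fintype.linearCombination A MvPolynomial.X

/-- The image `F₁` of the free module `F = A^r` inside `S = Sym_A(F)`. -/
noncomputable def freeSub (A : Type) [CommRing A] (r : ℕ) :
    Submodule A (MvPolynomial (Fin r) A) :=
  Submodule.map (emb A r) ⊤

/-- The image `M₁` of a submodule `M ⊆ F` inside `S = Sym_A(F)`. -/
noncomputable def sub1 (A : Type) [CommRing A] (r : ℕ) (M : Submodule A (Fin r → A)) :
    Submodule A (MvPolynomial (Fin r) A) :=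
  M.map (emb A r)

/-- The Rees algebra `R(M)` of `M ⊆ F`, i.e. the `A`-subalgebra of `S = Sym_A(F)`
generated by the degree-one part `M₁`; its `n`-th homogeneous component is `M₁ ^ n`. -/
noncomputable abbrev reesAlg (A : Type) [CommRing A] (r : ℕ) (M : Submodule A (Fin r → A)) :
    Subalgebra A (MvPolynomial (Fin r) A) :=
  Algebra.adjoin A (sub1 A r M : Set (MvPolynomial (Fin r) A))

/-- The Ratliff--Rush closure `⋃_{ℓ > 0} [N^{ℓ+1} :_{Fn} N^ℓ]` of `N` (inside `Fn`),
where all powers and quotients of submodules are taken inside `S = Sym_A(F)`. -/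
noncomputable def ratliffRush (A : Type) [CommRing A] (r : ℕ)
    (Fn N : Submodule A (MvPolynomial (Fin r) A)) : Submodule A (MvPolynomial (Fin r) A) :=
  ⨆ ℓ : ℕ, (Fn ⊓ (N ^ (ℓ + 2) / N ^ (ℓ + 1)))

/-- The positive part `R₊ = ker(constant term)` of a graded subalgebra `R₀ ⊆ S`. -/
noncomputable def posPart (A : Type) [CommRing A] (r : ℕ)
    (R0 : Subalgebra A (MvPolynomial (Fin r) A)) : Ideal ↥R0 :=
  RingHom.ker ((MvPolynomial.constantCoeff).comp R0.val.toRingHom)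

/-- `widetilde{R₀} = ε⁻¹(H⁰_{R₀₊}(S/R₀))`, i.e., the set of `x ∈ S` annihilated into `R₀`
by a power of the irrelevant ideal `R₀₊`; a graded subring of `S` containing `R₀`. -/
noncomputable def rrAlg (A : Type) [CommRing A] (r : ℕ)
    (R0 : Subalgebra A (MvPolynomial (Fin r) A)) : Subalgebra A (MvPolynomial (Fin r) A) where
  carrier := {x | ∃ m : ℕ, ∀ y ∈ (posPart A r R0) ^ m,
    (y : MvPolynomial (Fin r) A) * x ∈ R0}
  mul_mem' := by
    rintro x₁ x₂ ⟨m₁, h₁⟩ ⟨m₂, h₂⟩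
    refine ⟨m₁ + m₂, fun y hy => ?_⟩
    rw [pow_add] at hy
    refine Submodule.mul_induction_on hy (fun p hp q hq => ?_) (fun a b ha hb => ?_)
    · have : ((p * q : ↥R0) : MvPolynomial (Fin r) A) * (x₁ * x₂)
          = ((p : MvPolynomial (Fin r) A) * x₁) * ((q : MvPolynomial (Fin r) A) * x₂) := by
        push_cast; ring
      rw [this]
      exact mul_mem (h₁ p hp) (h₂ q hq)
    · have : ((a + b : ↥R0) : MvPolynomial (Fin r) A) * (x₁ * x₂)
          = (a : MvPolynomial (Fin r) A) * (x₁ * x₂)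
            + (b : MvPolynomial (Fin r) A) * (x₁ * x₂) := by
        push_cast; ring
      rw [this]
      exact add_mem ha hb
  one_mem' := ⟨0, fun y _ => by rw [mul_one]; exact y.2⟩
  add_mem' := by
    rintro x₁ x₂ ⟨m₁, h₁⟩ ⟨m₂, h₂⟩
    refine ⟨m₁ + m₂, fun y hy => ?_⟩
    rw [mul_add]
    exact add_mem (h₁ y (Ideal.pow_le_pow_right (Nat.le_add_right _ _) hy))
      (h₂ y (Ideal.pow_le_pow_right (Nat.le_add_left _ _) hy))
  zero_mem' := ⟨0, fun y _ => by simpa using R0.zero_mem⟩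
  algebraMap_mem' := fun a =>
    ⟨0, fun y _ => mul_mem y.2 (R0.algebraMap_mem a)⟩

/-- The integral closure of the Rees algebra `R(M)` inside `S = Sym_A(F)`,
viewed as an `A`-subalgebra of `S`. -/
noncomputable def intClAlg (A : Type) [CommRing A] (r : ℕ) (M : Submodule A (Fin r → A)) :
    Subalgebra A (MvPolynomial (Fin r) A) :=
  (integralClosure (↥(reesAlg A r M)) (MvPolynomial (Fin r) A)).restrictScalars A

/-- The integral closure `overline{M^n}`: the `n`-th homogeneous component of the
integral closure of `R(M)` in `S`. -/
noncomputable def barPow (A : Type) [CommRing A] (r : ℕ) (M : Submodule A (Fin r → A))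
    (n : ℕ) : Submodule A (MvPolynomial (Fin r) A) :=
  (freeSub A r) ^ n ⊓ (Subalgebra.toSubmodule (intClAlg A r M))

/-- `M` is a faithful `A`-module. -/
def faithfulSub (A : Type) [CommRing A] (r : ℕ) (M : Submodule A (Fin r → A)) : Prop :=
  ∀ a : A, (∀ x ∈ M, a • x = (0 : Fin r → A)) → a = 0

/-- The length of an `A`-module, as the Krull dimension of its lattice of submodules. -/
noncomputable def modLength (A : Type) [CommRing A] (N : Type) [AddCommGroup N]
    [Module A N] : WithBot ℕ∞ :=
  Order.krullDim (Submodule A N)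

/-- The quotient module `P/N` of two submodules of `S`. -/
abbrev quotNP (A : Type) [CommRing A] (r : ℕ)
    (N P : Submodule A (MvPolynomial (Fin r) A)) :=
  ↥P ⧸ (N.comap P.subtype)

/-- The minimal number of generators of a submodule. -/
noncomputable def minGen (A : Type) [CommRing A] {V : Type} [AddCommGroup V] [Module A V]
    (N : Submodule A V) : ℕ :=
  sInf {n : ℕ | ∃ f : Fin n → V, Submodule.span A (Set.range f) = N}

/-- A Noetherian local ring is Cohen--Macaulay if its depth equals its Krull dimension,
i.e. there is a regular sequence in the maximal ideal whose length is the dimension. -/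
def IsCohenMacaulayLocalRing (R : Type) [CommRing R] [IsLocalRing R] : Prop :=
  ∃ rs : List R, (∀ x ∈ rs, x ∈ maximalIdeal R) ∧
    RingTheory.Sequence.IsRegular R rs ∧ (rs.length : WithBot ℕ∞) = ringKrullDim R

/-- A Noetherian local ring is Buchsbaum (in the sense of Stückrad--Vogel) if every
system of parameters `x_1, …, x_d` is a weak sequence:
`(x_1, …, x_{i-1}) : x_i ⊆ (x_1, …, x_{i-1}) : 𝔪` for all `i`. -/
def IsBuchsbaumLocalRing (R : Type) [CommRing R] [IsLocalRing R] : Prop :=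
  ∀ d : ℕ, ringKrullDim R = d →
    ∀ x : Fin d → R, (∀ i, x i ∈ maximalIdeal R) →
      maximalIdeal R ≤ (Ideal.span (Set.range x)).radical →
      ∀ i : Fin d,
        (Ideal.span (x '' {j | j < i})).colon (Ideal.span {x i}) ≤
          (Ideal.span (x '' {j | j < i})).colon (maximalIdeal R)

/-- An ideal `P` of a graded subalgebra `R₀ ⊆ S` is graded (homogeneous) if it contains,
together with any element, all of its homogeneous components. -/
def IsGradedIdeal (A : Type) [CommRing A] (r : ℕ)
    (R0 : Subalgebra A (MvPolynomial (Fin r) A)) (P : Ideal ↥R0) : Prop :=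
  ∀ x : ↥R0, x ∈ P → ∀ n : ℕ,
    ∀ h : MvPolynomial.homogeneousComponent n (x : MvPolynomial (Fin r) A) ∈ R0,
      (⟨_, h⟩ : ↥R0) ∈ P

/-- The graded maximal ideal `𝔐 = 𝔪 R(M) + R(M)₊` of the Rees algebra, i.e. the
preimage of the maximal ideal under the degree-zero projection. -/
noncomputable abbrev gradedMax (A : Type) [CommRing A] [IsLocalRing A] (r : ℕ)
    (M : Submodule A (Fin r → A)) : Ideal ↥(reesAlg A r M) :=
  Ideal.comap ((MvPolynomial.constantCoeff).comp (reesAlg A r M).val.toRingHom)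
    (maximalIdeal A)


/-- The Rees algebra of an abstract module `M` with respect to an embedding
`ι : M → A^k` into a finite free module: the subalgebra of `Sym_A(A^k)` generated by
the image of `M` in degree one. -/
noncomputable abbrev reesOf (A : Type) [CommRing A] (M : Type) [AddCommGroup M]
    [Module A M] (k : ℕ) (ι : M →ₗ[A] (Fin k → A)) :
    Subalgebra A (MvPolynomial (Fin k) A) :=
  Algebra.adjoin A
    ((Submodule.map ((emb A k) ∘ₗ ι) ⊤ : Submodule A (MvPolynomial (Fin k) A)) :
      Set (MvPolynomial (Fin k) A))

theorem normal_mv (A : Type) [CommRing A] [IsDomain A] [IsIntegrallyClosed A] (r : ℕ) :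
    IsIntegrallyClosed (MvPolynomial (Fin r) A) := by
  induction r with
  | zero => exact IsIntegrallyClosed.of_equiv (isEmptyAlgEquiv A (Fin 0)).symm.toRingEquiv
  | succ n ih => exact IsIntegrallyClosed.of_equiv (finSuccEquiv A n).symm.toRingEquiv

theorem dual_ext (A : Type) [CommRing A] [IsDomain A] (M : Type) [AddCommGroup M] [Module A M]
    (g : ℕ) (ψ : M →ₗ[A] (Fin g → A)) (hψ : Function.Injective ψ) (α : M →ₗ[A] A) :
    ∃ c : A, c ≠ 0 ∧ ∃ γ : (Fin g → A) →ₗ[A] A, c • α = γ ∘ₗ ψ := by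
  let K := FractionRing A
  let S := nonZeroDivisors A
  let ψK : LocalizedModule S M →ₗ[K] LocalizedModule S (Fin g → A) := LocalizedModule.map S ψ
  let αK : LocalizedModule S M →ₗ[K] LocalizedModule S A := LocalizedModule.map S α
  have hK : Function.Injective ψK := LocalizedModule.map_injective S ψ hψ
  obtain ⟨l, hl⟩ := ψK.exists_leftInverse_of_injective (LinearMap.ker_eq_bot.mpr hK)
  let β : LocalizedModule S (Fin g → A) →ₗ[K] LocalizedModule S A := αK ∘ₗ l
  have hβ : ∀ m, β (LocalizedModule.mkLinearMap S _ (ψ m)) = LocalizedModule.mkLinearMap S _ (α m) := by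
    intro m
    have h1 : ψK (LocalizedModule.mkLinearMap S _ m) = LocalizedModule.mkLinearMap S _ (ψ m) := by
      exact LocalizedModule.map_mk S ψ m 1
    rw [← h1]
    have := LinearMap.congr_fun hl (LocalizedModule.mkLinearMap S _ m)
    simp only [LinearMap.comp_apply, LinearMap.id_apply] at this
    simp only [β, LinearMap.comp_apply, this]
    exact LocalizedModule.map_mk S α m 1
  obtain ⟨c, hc⟩ := IsLocalizedModule.exist_integer_multiples_of_finite S (LocalizedModule.mkLinearMap S A)
    (fun i : Fin g => β (LocalizedModule.mkLinearMap S _ (Pi.single i 1)))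
  choose d hd using hc
  refine ⟨c, nonZeroDivisors.coe_ne_zero c, Fintype.linearCombination A d, ?_⟩
  ext m
  have inj : Function.Injective (LocalizedModule.mkLinearMap S A) := by
    rw [IsLocalizedModule.injective_iff_isRegular (S := S)]
    intro c
    exact (IsRegular.of_ne_zero (nonZeroDivisors.coe_ne_zero c)).left.isSMulRegular
  apply inj
  have e : ψ m = ∑ i, ψ m i • Pi.single i (1:A) := by
    ext j; simp [Finset.sum_apply, Pi.single_apply]
  rw [LinearMap.smul_apply, map_smul, ← hβ]
  simp only [LinearMap.comp_apply, Fintype.linearCombination_apply, map_sum, map_smul, hd]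
  conv_lhs => rw [e]
  have : β.restrictScalars A (LocalizedModule.mkLinearMap S _ (∑ i, ψ m i • Pi.single i (1:A))) = ∑ i, ψ m i • β (LocalizedModule.mkLinearMap S _ (Pi.single i (1:A))) := by
    simp only [map_sum, map_smul]; rfl
  rw [LinearMap.restrictScalars_apply] at this
  rw [this, Finset.smul_sum]
  refine Finset.sum_congr rfl fun i _ => ?_
  rw [smul_comm]

theorem scale_coeff (A : Type) [CommRing A] (r : ℕ) (c : Fin r → A) (p : MvPolynomial (Fin r) A) (m : Fin r →₀ ℕ) :
    coeff m (aeval (fun i => c i • (X i : MvPolynomial (Fin r) A)) p) = (m.prod fun i k => c i ^ k) * coeff m p := by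
  induction p using MvPolynomial.induction_on' with
  | monomial u a =>
    rw [aeval_monomial]
    have : (u.prod fun i k => (c i • (X i : MvPolynomial (Fin r) A)) ^ k) = monomial u (u.prod fun i k => c i ^ k) := by
      rw [monomial_eq]
      simp only [smul_eq_C_mul, mul_pow, Finsupp.prod_mul, ← map_pow]
      rw [map_finsuppProd]
    rw [this, MvPolynomial.algebraMap_eq, C_mul_monomial, coeff_monomial, coeff_monomial]
    split_ifs with h
    · subst h; ring
    · simp
  | add p q hp hq => simp only [map_add, coeff_add, hp, hq, mul_add]

theorem normal_trick (S T : Type) [CommRing S] [IsDomain S] [IsIntegrallyClosed S] [CommRing T] [IsDomain T]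
    (f : S →+* T) (hf : Function.Injective f) (x : T) (hx : f.IsIntegralElem x) (a s : S) (ha : a ≠ 0)
    (h : f a * x = f s) : ∃ y, f y = x := by
  let K := FractionRing S
  let L := FractionRing T
  have hg : Function.Injective ((algebraMap T L).comp f) := (IsFractionRing.injective T L).comp hf
  let i : K →+* L := IsFractionRing.lift hg
  have hi : ∀ z, i (algebraMap S K z) = algebraMap T L (f z) := fun z => IsFractionRing.lift_algebraMap hg z
  let q : K := algebraMap S K s / algebraMap S K a
  have hfa : algebraMap T L (f a) ≠ 0 := by
    intro h0; apply ha; apply hg; simpa using h0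
  have hq : i q = algebraMap T L x := by
    simp only [q, map_div₀, hi, ← h, map_mul]
    exact mul_div_cancel_left₀ _ hfa
  obtain ⟨p, hp, hpx⟩ := hx
  have : IsIntegral S q := by
    refine ⟨p, hp, i.injective ?_⟩
    rw [Polynomial.hom_eval₂, hq, map_zero]
    have e : i.comp (algebraMap S K) = (algebraMap T L).comp f := by ext z; exact hi z
    rw [e, ← Polynomial.hom_eval₂, hpx, map_zero]
  obtain ⟨y, hy⟩ := IsIntegrallyClosed.isIntegral_iff.mp this
  refine ⟨y, IsFractionRing.injective T L ?_⟩
  rw [← hi, hy, hq]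

section rees
variable {A : Type} [CommRing A] {k : ℕ} (N : Submodule A (MvPolynomial (Fin k) A))

theorem adjoin_decomp :
    Subalgebra.toSubmodule (Algebra.adjoin A (N : Set (MvPolynomial (Fin k) A))) ≤
      1 ⊔ N * Subalgebra.toSubmodule (Algebra.adjoin A (N : Set (MvPolynomial (Fin k) A))) := by
  set R := Algebra.adjoin A (N : Set (MvPolynomial (Fin k) A)) with hR
  intro x hx
  rw [Subalgebra.mem_toSubmodule] at hx
  have hself : Subalgebra.toSubmodule R * Subalgebra.toSubmodule R ≤ Subalgebra.toSubmodule R := by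
    rw [Submodule.mul_le]
    exact fun a ha b hb => R.mul_mem ha hb
  have hNR : N ≤ Subalgebra.toSubmodule R := fun z hz => Algebra.subset_adjoin hz
  have hle : N * Subalgebra.toSubmodule R ≤ Subalgebra.toSubmodule R :=
    (mul_le_mul_left hNR _).trans hself
  have key : (1 ⊔ N * Subalgebra.toSubmodule R) * (1 ⊔ N * Subalgebra.toSubmodule R)
      ≤ 1 ⊔ N * Subalgebra.toSubmodule R := by
    rw [Submodule.sup_mul, one_mul]
    refine sup_le le_rfl (le_sup_of_le_right ?_)
    rw [mul_assoc]
    refine mul_le_mul_right ?_ _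
    calc _ ≤ Subalgebra.toSubmodule R * Subalgebra.toSubmodule R := by
          refine mul_le_mul_right (sup_le ?_ hle) _
          rw [Submodule.one_le]; exact R.one_mem
      _ ≤ _ := hself
  induction hx using Algebra.adjoin_induction with
  | mem z hz =>
    refine Submodule.mem_sup_right ?_
    rw [← mul_one z]
    exact Submodule.mul_mem_mul hz R.one_mem
  | algebraMap a => exact Submodule.mem_sup_left (Submodule.algebraMap_mem a)
  | add x y _ _ hx hy => exact add_mem hx hy
  | mul x y _ _ hx hy => exact key (Submodule.mul_mem_mul hx hy)

/-- reesmod m = N^m R. -/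
theorem pow_decomp (m : ℕ) :
    N ^ m * Subalgebra.toSubmodule (Algebra.adjoin A (N : Set (MvPolynomial (Fin k) A))) ≤
      N ^ m ⊔ N ^ (m + 1) * Subalgebra.toSubmodule (Algebra.adjoin A (N : Set (MvPolynomial (Fin k) A))) := by
  refine (mul_le_mul_right (adjoin_decomp N) (N ^ m)).trans (le_of_eq ?_)
  rw [Submodule.mul_sup, mul_one, ← mul_assoc, ← pow_succ]

theorem mul_mem_ideal (hN : N ≤ homogeneousSubmodule (Fin k) A 1) (m : ℕ)
    (P : Submodule A (MvPolynomial (Fin k) A)) :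
    N ^ m * P ≤ (idealOfVars (Fin k) A ^ m).restrictScalars A := by
  have h1 : N ^ m ≤ homogeneousSubmodule (Fin k) A m := by
    induction m with
    | zero => rw [pow_zero, Submodule.one_le]; exact isHomogeneous_one _ _
    | succ n ih =>
      rw [pow_succ]
      exact (mul_le_mul' ih hN).trans (homogeneousSubmodule_mul n 1)
  rw [Submodule.mul_le]
  intro y hy z _
  refine Ideal.mul_mem_right _ _ ?_
  rw [mem_pow_idealOfVars_iff]
  intro d hd
  have := (mem_homogeneousSubmodule _ _).mp (h1 hy)
  rw [mem_support_iff] at hd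
  have h2 := this hd
  rw [Finsupp.degree_eq_weight_one]
  exact h2.ge

theorem homog_pow (hN : N ≤ homogeneousSubmodule (Fin k) A 1) (m : ℕ) :
    N ^ m ≤ homogeneousSubmodule (Fin k) A m := by
  induction m with
  | zero => rw [pow_zero, Submodule.one_le]; exact isHomogeneous_one _ _
  | succ n ih =>
    rw [pow_succ]
    exact (mul_le_mul' ih hN).trans (homogeneousSubmodule_mul n 1)

theorem homog_zero (m : ℕ) (y : MvPolynomial (Fin k) A) (hy : y.IsHomogeneous m)
    (h : y ∈ idealOfVars (Fin k) A ^ (m + 1)) : y = 0 := by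
  rw [mem_pow_idealOfVars_iff] at h
  by_contra h0
  obtain ⟨d, hd⟩ := Finset.nonempty_iff_ne_empty.mpr (fun e => h0 (support_eq_empty.mp e))
  have h1 := h d hd
  have h2 := hy (mem_support_iff.mp hd)
  rw [Finsupp.degree_eq_weight_one] at h1
  have h3 : Finsupp.weight (1 : Fin k → ℕ) d = m := h2
  change m + 1 ≤ Finsupp.weight (1 : Fin k → ℕ) d at h1
  omega

theorem adjoin_order (hN : N ≤ homogeneousSubmodule (Fin k) A 1) (m : ℕ)
    (y : MvPolynomial (Fin k) A) (hy : y ∈ Algebra.adjoin A (N : Set (MvPolynomial (Fin k) A)))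
    (h : y ∈ idealOfVars (Fin k) A ^ m) :
    y ∈ N ^ m * Subalgebra.toSubmodule (Algebra.adjoin A (N : Set (MvPolynomial (Fin k) A))) := by
  induction m with
  | zero => rw [pow_zero, one_mul]; exact hy
  | succ n ih =>
    have h1 := pow_decomp N n (ih (Ideal.pow_le_pow_right (Nat.le_succ n) h))
    obtain ⟨u, hu, v, hv, rfl⟩ := Submodule.mem_sup.mp h1
    have hv' : v ∈ idealOfVars (Fin k) A ^ (n + 1) := mul_mem_ideal N hN (n + 1) _ hv
    have hu' : u ∈ idealOfVars (Fin k) A ^ (n + 1) := (Ideal.add_mem_iff_left _ hv').mp h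
    have : u = 0 := homog_zero n u (homog_pow N hN n hu) hu'
    rw [this, zero_add]; exact hv

theorem const_mem (y : MvPolynomial (Fin k) A) (hy : constantCoeff y = 0) :
    y ∈ idealOfVars (Fin k) A ^ 1 := by
  rw [mem_pow_idealOfVars_iff]
  intro d hd
  rw [mem_support_iff] at hd
  by_contra h
  have : d.degree = 0 := by omega
  rw [Finsupp.degree_eq_zero_iff] at this
  subst this
  exact hd hy

theorem mem_rr_iff (hN : N ≤ homogeneousSubmodule (Fin k) A 1) (x : MvPolynomial (Fin k) A) :
    x ∈ rrAlg A k (Algebra.adjoin A (N : Set (MvPolynomial (Fin k) A))) ↔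
      ∃ m : ℕ, ∀ y ∈ N ^ m, y * x ∈ Algebra.adjoin A (N : Set (MvPolynomial (Fin k) A)) := by
  set R := Algebra.adjoin A (N : Set (MvPolynomial (Fin k) A)) with hR
  constructor
  · rintro ⟨m, hm⟩
    refine ⟨m, fun y hy => ?_⟩
    have : ∀ n : ℕ, N ^ n ≤ Submodule.map R.val.toLinearMap
        ((posPart A k R ^ n).restrictScalars A) := by
      intro n
      induction n with
      | zero =>
        rw [pow_zero, Submodule.one_le]
        exact ⟨1, by simp, by simp⟩
      | succ n ih =>
        rw [pow_succ, Submodule.mul_le]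
        intro a ha b hb
        obtain ⟨a', ha', rfl⟩ := ih ha
        have hbR : b ∈ R := Algebra.subset_adjoin hb
        refine ⟨a' * ⟨b, hbR⟩, ?_, by simp⟩
        change a' * ⟨b, hbR⟩ ∈ posPart A k R ^ (n + 1)
        rw [pow_succ]
        refine Ideal.mul_mem_mul ha' ?_
        change constantCoeff b = 0
        have := (mem_homogeneousSubmodule _ _).mp (hN hb)
        by_contra hne
        have h2 := this (d := 0) hne
        simp at h2
    obtain ⟨y', hy', rfl⟩ := this m hy
    exact hm y' hy'
  · rintro ⟨m, hm⟩
    refine ⟨m, fun y hy => ?_⟩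
    have h1 : (y : MvPolynomial (Fin k) A) ∈ idealOfVars (Fin k) A ^ m := by
      have : posPart A k R ≤ Ideal.comap R.val.toRingHom (idealOfVars (Fin k) A) := by
        intro z hz
        have := const_mem _ (show constantCoeff (z : MvPolynomial (Fin k) A) = 0 from hz)
        rwa [pow_one] at this
      exact Ideal.le_comap_pow _ m (Ideal.pow_right_mono this m hy)
    have h2 := adjoin_order N hN m y y.2 h1
    refine Submodule.mul_induction_on h2 (fun a ha b hb => ?_) (fun a b ha hb => ?_)
    · have : a * b * x = b * (a * x) := by ring
      rw [this]
      exact R.mul_mem hb (hm a ha)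
    · rw [add_mul]; exact add_mem ha hb

theorem rr_integral [IsDomain A] (hN : N ≤ homogeneousSubmodule (Fin k) A 1) (hfg : N.FG)
    (h0 : N ≠ ⊥) (x : MvPolynomial (Fin k) A) (m : ℕ)
    (hm : ∀ y ∈ N ^ m, y * x ∈ Algebra.adjoin A (N : Set (MvPolynomial (Fin k) A))) :
    IsIntegral (Algebra.adjoin A (N : Set (MvPolynomial (Fin k) A))) x := by
  set R := Algebra.adjoin A (N : Set (MvPolynomial (Fin k) A)) with hR
  let J : Submodule R (MvPolynomial (Fin k) A) := Submodule.span R ((N ^ m : Submodule A _) : Set _)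
  have hJ : N ^ m * Subalgebra.toSubmodule R ≤ J.restrictScalars A := by
    rw [Submodule.mul_le]
    intro a ha b hb
    have : a * b = (⟨b, hb⟩ : R) • a := by
      rw [Subalgebra.smul_def]; exact mul_comm _ _
    rw [this]
    exact J.smul_mem _ (Submodule.subset_span ha)
  refine isIntegral_of_smul_mem_submodule J ?_ ?_ x ?_
  · obtain ⟨f, hf, hf0⟩ := Submodule.exists_mem_ne_zero_of_ne_bot h0
    intro hb
    have : f ^ m ∈ J := Submodule.subset_span (Submodule.pow_mem_pow N hf m)
    rw [hb, Submodule.mem_bot] at this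
    exact pow_ne_zero m hf0 this
  · obtain ⟨s, hs⟩ := Submodule.FG.pow hfg m
    refine ⟨s, ?_⟩
    change _ = Submodule.span R ((N ^ m : Submodule A _) : Set (MvPolynomial (Fin k) A))
    rw [← hs, Submodule.span_span_of_tower]
  · intro n hn
    induction hn using Submodule.span_induction with
    | mem y hy =>
      have h1 : y * x ∈ idealOfVars (Fin k) A ^ m := by
        refine mul_mem_ideal N hN m ⊤ (Submodule.mul_mem_mul hy trivial)
      rw [smul_eq_mul, mul_comm]
      exact hJ (adjoin_order N hN m _ (hm y hy) h1)
    | zero => simp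
    | add a b _ _ ha hb => rw [smul_add]; exact add_mem ha hb
    | smul c a _ ha => rw [smul_comm]; exact J.smul_mem _ ha

end rees

theorem main_aux (A : Type) [CommRing A] [IsDomain A] [IsIntegrallyClosed A] (r g : ℕ)
    (Φ : MvPolynomial (Fin r) A →ₐ[A] MvPolynomial (Fin g) A) (hΦ : Function.Injective Φ)
    (N : Submodule A (MvPolynomial (Fin r) A)) (hN : N ≤ homogeneousSubmodule (Fin r) A 1)
    (hN' : N.map Φ.toLinearMap ≤ homogeneousSubmodule (Fin g) A 1) (hfg : N.FG) (h0 : N ≠ ⊥) :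
    (rrAlg A r (Algebra.adjoin A (N : Set (MvPolynomial (Fin r) A)))).map Φ =
      rrAlg A g (Algebra.adjoin A
        ((N.map Φ.toLinearMap : Submodule A _) : Set (MvPolynomial (Fin g) A))) := by
  have hR : (Algebra.adjoin A (N : Set (MvPolynomial (Fin r) A))).map Φ = Algebra.adjoin A
        ((N.map Φ.toLinearMap : Submodule A _) : Set (MvPolynomial (Fin g) A)) := by
    rw [AlgHom.map_adjoin]; rfl
  have hpow : ∀ m, (N.map Φ.toLinearMap) ^ m = (N ^ m).map Φ.toLinearMap := fun m =>
    (Submodule.map_pow N Φ m).symm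
  have hmem : ∀ x, Φ x ∈ rrAlg A g (Algebra.adjoin A
        ((N.map Φ.toLinearMap : Submodule A _) : Set (MvPolynomial (Fin g) A))) ↔
      x ∈ rrAlg A r (Algebra.adjoin A (N : Set (MvPolynomial (Fin r) A))) := by
    intro x
    rw [mem_rr_iff _ hN, mem_rr_iff _ hN']
    refine exists_congr fun m => ?_
    rw [hpow, ← hR]
    constructor
    · intro h y hy
      obtain ⟨z, hz, hzy⟩ := h (Φ y) ⟨y, hy, rfl⟩
      have : Φ z = Φ (y * x) := by rw [map_mul]; exact hzy
      rw [← hΦ this]; exact hz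
    · rintro h _ ⟨y, hy, rfl⟩
      exact ⟨y * x, h y hy, map_mul Φ y x⟩
  have := normal_mv A r
  apply le_antisymm
  · rintro _ ⟨x, hx, rfl⟩
    exact (hmem x).mpr hx
  · intro x hx
    obtain ⟨m, hm⟩ := (mem_rr_iff _ hN' x).mp hx
    have hint := rr_integral _ hN' (hfg.map _) (by
      intro hb
      apply h0
      rw [eq_bot_iff]
      intro z hz
      have h2 : Φ z ∈ N.map Φ.toLinearMap := ⟨z, hz, rfl⟩
      rw [hb, Submodule.mem_bot] at h2
      exact hΦ (by rw [h2, map_zero])) x m hm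
    obtain ⟨f, hf, hf0⟩ := Submodule.exists_mem_ne_zero_of_ne_bot h0
    have h1 := hm (Φ (f ^ m)) (by
      rw [hpow]; exact ⟨f ^ m, Submodule.pow_mem_pow N hf m, rfl⟩)
    rw [← hR] at h1
    obtain ⟨s, _, hs⟩ := h1
    have hint2 : Φ.toRingHom.IsIntegralElem x := by
      rw [← hR] at hint
      have h2 : IsIntegral Φ.range x := by
        obtain ⟨p, hp, hpx⟩ := hint
        have hle : (Algebra.adjoin A (N : Set (MvPolynomial (Fin r) A))).map Φ ≤ Φ.range := by
          rintro _ ⟨z, _, rfl⟩; exact ⟨z, rfl⟩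
        refine ⟨p.map (Subalgebra.inclusion hle).toRingHom, hp.map _, ?_⟩
        rw [Polynomial.eval₂_map]
        exact hpx
      obtain ⟨p, hp, hpx⟩ := h2
      let e := AlgEquiv.ofInjective Φ hΦ
      refine ⟨p.map e.symm.toRingEquiv.toRingHom, hp.map _, ?_⟩
      rw [Polynomial.eval₂_map]
      have : Φ.toRingHom.comp e.symm.toRingEquiv.toRingHom = algebraMap Φ.range _ := by
        ext1 z
        obtain ⟨w, rfl⟩ := e.surjective z
        change Φ (e.symm (e w)) = _
        rw [AlgEquiv.symm_apply_apply]; rfl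
      rw [this]; exact hpx
    obtain ⟨y, hy⟩ := normal_trick _ _ Φ.toRingHom hΦ x hint2 (f ^ m) s (pow_ne_zero m hf0) hs.symm
    have hy' : Φ y = x := hy
    subst hy'
    exact ⟨y, (hmem y).mp hx, rfl⟩

theorem emb_homog (A : Type) [CommRing A] (r : ℕ) (v : Fin r → A) :
    emb A r v ∈ homogeneousSubmodule (Fin r) A 1 := by
  rw [emb, Fintype.linearCombination_apply]
  exact sum_mem fun i _ => Submodule.smul_mem _ _ (isHomogeneous_X A i)

theorem emb_inj (A : Type) [CommRing A] (r : ℕ) : Function.Injective (emb A r) := by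
  intro v w h
  ext i
  have := congrArg (coeff (Finsupp.single i 1)) h
  simpa [emb, Fintype.linearCombination_apply, coeff_sum, coeff_X', Finsupp.single_left_inj] using this

/-- functoriality of Sym -/
noncomputable def symMap (A : Type) [CommRing A] (r g : ℕ) (φ : (Fin r → A) →ₗ[A] (Fin g → A)) :
    MvPolynomial (Fin r) A →ₐ[A] MvPolynomial (Fin g) A :=
  aeval fun i => emb A g (φ (Pi.single i 1))

theorem symMap_emb (A : Type) [CommRing A] (r g : ℕ) (φ : (Fin r → A) →ₗ[A] (Fin g → A))
    (v : Fin r → A) : symMap A r g φ (emb A r v) = emb A g (φ v) := by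
  have : (symMap A r g φ).toLinearMap ∘ₗ emb A r = emb A g ∘ₗ φ := by
    refine LinearMap.pi_ext' fun i => LinearMap.ext_ring ?_
    simp [symMap, emb, Fintype.linearCombination_apply, Pi.single_apply]
  exact LinearMap.congr_fun this v

theorem symMap_inj (A : Type) [CommRing A] [IsDomain A] (r g : ℕ) (φ : (Fin r → A) →ₗ[A] (Fin g → A))
    (hφ : Function.Injective φ) : Function.Injective (symMap A r g φ) := by
  have h := fun i => dual_ext A (Fin r → A) g φ hφ (LinearMap.proj i)
  choose c hc γ hγ using h
  have key : (symMap A g r (LinearMap.pi γ)).comp (symMap A r g φ) =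
      aeval (fun i => c i • (X i : MvPolynomial (Fin r) A)) := by
    ext1 i
    have h1 : symMap A r g φ (X i) = emb A g (φ (Pi.single i 1)) := by simp [symMap]
    rw [AlgHom.comp_apply, h1, symMap_emb, aeval_X]
    have : LinearMap.pi γ (φ (Pi.single i 1)) = Pi.single i (c i) := by
      ext j
      have := LinearMap.congr_fun (hγ j) (Pi.single i 1)
      simp only [LinearMap.smul_apply, LinearMap.proj_apply, LinearMap.comp_apply] at this
      rw [LinearMap.pi_apply, ← this]
      by_cases hij : j = i
      · subst hij; simp
      · simp [hij]
    rw [this]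
    simp [emb]
  rw [injective_iff_map_eq_zero]
  intro p hp
  have h1 : aeval (fun i => c i • (X i : MvPolynomial (Fin r) A)) p = 0 := by
    rw [← key, AlgHom.comp_apply, hp, map_zero]
  ext m
  have h2 := scale_coeff A r c p m
  rw [h1, coeff_zero, eq_comm, mul_eq_zero] at h2
  rcases h2 with h2 | h2
  · exact absurd h2 (Finset.prod_ne_zero_iff.mpr fun i _ => pow_ne_zero _ (hc i))
  · rw [h2, coeff_zero]


/-- Proposition 3.6. Let `A` be a normal Noetherian domain and `M` an
ideal module: a nonzero finitely generated torsion-free `A`-module whose double dual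
`M** ≃ A^r` (`r > 0`) is free, into which `M` embeds canonically via the biduality map.
If `M` is also embedded into a finite free module `G = A^g` of positive rank via `ψ`, then
`widetilde{R(M)}^S ≅ widetilde{R(M)}^T` as `A`-algebras, where `S = Sym_A(M**)` and
`T = Sym_A(G)`; in particular, up to isomorphism, the Ratliff--Rush closure does not
depend on the choice of the embedding of `M`. -/
theorem ratliffRush_statement_4 (A : Type) [CommRing A] [IsDomain A]
    [IsIntegrallyClosed A] [IsNoetherianRing A]
    (M : Type) [AddCommGroup M] [Module A M] [Module.Finite A M]
    [Nontrivial M] [NoZeroSMulDivisors A M]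
    (r : ℕ) (hr : 0 < r)
    (b : Module.Dual A (Module.Dual A M) ≃ₗ[A] (Fin r → A))
    (g : ℕ) (hg : 0 < g)
    (ψ : M →ₗ[A] (Fin g → A)) (hψ : Function.Injective ψ) :
    Nonempty
      (↥(rrAlg A r (reesOf A M r (b.toLinearMap ∘ₗ Module.Dual.eval A M)))
        ≃ₐ[A] ↥(rrAlg A g (reesOf A M g ψ))) := by
  let φ : (Fin r → A) →ₗ[A] (Fin g → A) :=
    LinearMap.pi fun i =>
      (Module.Dual.eval A (Module.Dual A M) (LinearMap.proj i ∘ₗ ψ)) ∘ₗ b.symm.toLinearMap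
  have hφ : Function.Injective φ := by
    rw [injective_iff_map_eq_zero]
    intro v hv
    have h1 : ∀ i, b.symm v (LinearMap.proj i ∘ₗ ψ) = 0 := fun i => congrFun hv i
    have h2 : b.symm v = 0 := by
      ext α
      obtain ⟨c, hc, γ, hγ⟩ := dual_ext A M g ψ hψ α
      have h3 : c • α = ∑ i, γ (Pi.single i 1) • ((LinearMap.proj i ∘ₗ ψ : M →ₗ[A] A)) := by
        rw [hγ]
        ext m
        have e : ψ m = ∑ i, ψ m i • Pi.single i (1:A) := by
          ext j; simp [Finset.sum_apply, Pi.single_apply]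
        rw [LinearMap.comp_apply, e]
        simp only [map_sum, map_smul, LinearMap.sum_apply, LinearMap.smul_apply,
          LinearMap.comp_apply, LinearMap.proj_apply, smul_eq_mul]
        exact Finset.sum_congr rfl fun i _ => mul_comm _ _
      have h4 : c • b.symm v α = 0 := by
        rw [← map_smul, h3, map_sum]
        refine Finset.sum_eq_zero fun i _ => ?_
        rw [map_smul, h1 i, smul_zero]
      exact (smul_eq_zero.mp h4).resolve_left hc
    simpa using h2
  have hφι : φ ∘ₗ (b.toLinearMap ∘ₗ Module.Dual.eval A M) = ψ := by
    ext m i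
    simp [φ]
  set ι := b.toLinearMap ∘ₗ Module.Dual.eval A M with hι
  let N : Submodule A (MvPolynomial (Fin r) A) := Submodule.map (emb A r ∘ₗ ι) ⊤
  have hN : N ≤ homogeneousSubmodule (Fin r) A 1 := by
    rintro _ ⟨m, _, rfl⟩
    exact emb_homog A r _
  have hmap : N.map (symMap A r g φ).toLinearMap = Submodule.map (emb A g ∘ₗ ψ) ⊤ := by
    rw [← Submodule.map_comp]
    congr 1
    rw [← hφι]
    ext1 m
    exact symMap_emb A r g φ (ι m)
  have hN' : N.map (symMap A r g φ).toLinearMap ≤ homogeneousSubmodule (Fin g) A 1 := by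
    rw [hmap]
    rintro _ ⟨m, _, rfl⟩
    exact emb_homog A g _
  have hfg : N.FG := Module.Finite.fg_top.map _
  have h0 : N ≠ ⊥ := by
    intro h
    obtain ⟨m, hm⟩ := exists_ne (0 : M)
    have h1 : emb A r (ι m) ∈ N := ⟨m, trivial, rfl⟩
    rw [h, Submodule.mem_bot] at h1
    have h2 : ι m = 0 := emb_inj A r (by rw [h1, map_zero])
    apply hm
    apply hψ
    rw [← hφι, LinearMap.comp_apply, h2, map_zero, map_zero]
  have hinj := symMap_inj A r g φ hφ
  have hmain := main_aux A r g (symMap A r g φ) hinj N hN hN' hfg h0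
  rw [hmap] at hmain
  exact ⟨(Subalgebra.equivMapOfInjective _ _ hinj).trans (Subalgebra.equivOfEq _ _ hmain)⟩
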